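/- (Subdivision invariance of the twisted Green's function.) Let σ be a gauge field on 𝒢 and let N≥1. Let 𝒢^(N) be the electrical network obtained from 𝒢 by replacing each edge e={x,y}∈E (with a chosen orientation) by a path x=z^e_0, z^e_1, …, z^e_N=y through N−1 new interior vertices, where each of the N new edges carries conductance N·C(e); the boundary of 𝒢^(N) is still V_∂. Let σ^(N) be any gauge field on 𝒢^(N) such that for each e∈E with σ(e)=1 all N edges of the subdivided path of e carry the value 1, and for each e∈E with σ(e)=−1 exactly one of the N edges of the subdivided path of e carries the value −1 and the other N−1 carry 1. Then the σ^(N)-twisted Green's function of 𝒢^(N) with zero boundary conditions on V_∂, restricted to V×V, coincides with the σ-twisted Green's function of 𝒢: G^(N)_{σ^(N)}(x,y)=G_σ(x,y) for all x,y∈V_int. Equivalently, the restriction to V of the σ^(N)-twisted discrete GFF on 𝒢^(N) is distributed as the σ-twisted discrete GFF on 𝒢. -/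

import Mathlib

open scoped Classical

/-- The interior matrix of `−Δ_{H,τ}` (diagonal `W(x) = Σ_{z∼x} C(x,z)`, off-diagonal
`−τ(x,y)C(x,y)` for adjacent interior `x,y`). -/
noncomputable def minusTwistedLapMatrix {α : Type*} [Fintype α] (H : SimpleGraph α)
    (C τ : α → α → ℝ) (int : Finset α) : Matrix int int ℝ :=
  Matrix.of fun x y : int =>
    if (x : α) = (y : α) then ∑ z : α, (if H.Adj (x : α) z then C (x : α) z else 0)
    else if H.Adj (x : α) (y : α) then -(τ (x : α) (y : α) * C (x : α) (y : α)) else 0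

/-- The `τ`-twisted Green's function with zero boundary conditions: the inverse of the
interior matrix of `−Δ_{H,τ}`. -/
noncomputable def twistedGreen {α : Type*} [Fintype α] (H : SimpleGraph α)
    (C τ : α → α → ℝ) (int : Finset α) : Matrix int int ℝ :=
  (minusTwistedLapMatrix H C τ int)⁻¹

/-- The vertices of the `N`-fold subdivision `𝒢^(N)` of `G`: the original vertices,
together with `N − 1` new vertices on each edge. -/
abbrev SubVert {V : Type*} (G : SimpleGraph V) (N : ℕ) : Type _ :=
  V ⊕ (G.edgeSet × Fin (N - 1))

/-- The adjacency relation of the `N`-fold subdivision, relative to a chosen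
orientation `o` of the edges: each edge `e = {x,y}` (oriented as `(o e).1 → (o e).2`)
is replaced by the path `(o e).1, (e,0), (e,1), …, (e,N−2), (o e).2`. -/
def subAdj {V : Type*} (G : SimpleGraph V) (N : ℕ) (o : Sym2 V → V × V) :
    SubVert G N → SubVert G N → Prop
  | Sum.inl x, Sum.inl y => N = 1 ∧ G.Adj x y
  | Sum.inl x, Sum.inr (e, k) =>
      (x = (o e.1).1 ∧ (k : ℕ) = 0) ∨ (x = (o e.1).2 ∧ (k : ℕ) = N - 2)
  | Sum.inr (e, k), Sum.inl x =>
      (x = (o e.1).1 ∧ (k : ℕ) = 0) ∨ (x = (o e.1).2 ∧ (k : ℕ) = N - 2)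
  | Sum.inr (e, k), Sum.inr (e', k') =>
      e = e' ∧ ((k : ℕ) + 1 = (k' : ℕ) ∨ (k' : ℕ) + 1 = (k : ℕ))

/-- The `N`-fold subdivision `𝒢^(N)` of `G`, as a simple graph. -/
def subGraph {V : Type*} (G : SimpleGraph V) (N : ℕ) (o : Sym2 V → V × V) :
    SimpleGraph (SubVert G N) where
  Adj := subAdj G N o
  symm := by
    refine ⟨?_⟩
    rintro (x | ⟨e, k⟩) (y | ⟨e', k'⟩) h
    · exact ⟨h.1, h.2.symm⟩
    · exact h
    · exact h
    · exact ⟨h.1.symm, h.2.symm⟩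
  loopless := by
    refine ⟨?_⟩
    rintro (x | ⟨e, k⟩) h
    · exact G.loopless.irrefl x h.2
    · rcases h with ⟨-, h | h⟩ <;> omega

/-- The conductances of the `N`-fold subdivision: each of the `N` edges obtained by
subdividing the edge `e` carries conductance `N·C(e)`. -/
def subC {V : Type*} {G : SimpleGraph V} {N : ℕ} (o : Sym2 V → V × V)
    (C : V → V → ℝ) : SubVert G N → SubVert G N → ℝ
  | Sum.inl x, Sum.inl y => (N : ℝ) * C x y
  | Sum.inl _, Sum.inr (e, _) => (N : ℝ) * C (o e.1).1 (o e.1).2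
  | Sum.inr (e, _), _ => (N : ℝ) * C (o e.1).1 (o e.1).2

/-- The `k`-th vertex `z^e_k` of the subdivided path replacing the edge `e`
(`z^e_0 = (o e).1`, `z^e_N = (o e).2`). -/
def pathVert {V : Type*} (G : SimpleGraph V) (N : ℕ) (o : Sym2 V → V × V)
    (e : G.edgeSet) (k : ℕ) : SubVert G N :=
  if h0 : k = 0 then Sum.inl (o e.1).1
  else if hN : N ≤ k then Sum.inl (o e.1).2
  else Sum.inr (e, ⟨k - 1, by omega⟩)

/-- The interior of the subdivision: all new vertices, together with the original
interior vertices (the boundary of `𝒢^(N)` is still `V_∂`). -/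
noncomputable def subInterior {V : Type*} [Fintype V] [DecidableEq V]
    (G : SimpleGraph V) [DecidableRel G.Adj] (N : ℕ) (Vi : Finset V) :
    Finset (SubVert G N) :=
  Finset.univ.filter fun v => ∀ x : V, v = Sum.inl x → x ∈ Vi

/-- Function-level minus twisted Laplacian. -/
noncomputable def twLap {α : Type*} [Fintype α] (H : SimpleGraph α)
    (C τ : α → α → ℝ) (f : α → ℝ) (x : α) : ℝ :=
  ∑ z : α, if H.Adj x z then C x z * (f x - τ x z * f z) else 0

theorem twLap_mulVec {α : Type*} [Fintype α] (H : SimpleGraph α)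
    (C τ : α → α → ℝ) (int : Finset α) (f : α → ℝ) (hf : ∀ x, x ∉ int → f x = 0) (x : int) :
    (minusTwistedLapMatrix H C τ int).mulVec (fun y : int => f y) x = twLap H C τ f x := by
  classical
  set A : α → α → ℝ := fun x y =>
    if x = y then ∑ z : α, (if H.Adj x z then C x z else 0)
    else if H.Adj x y then -(τ x y * C x y) else 0 with hA
  have h1 : (minusTwistedLapMatrix H C τ int).mulVec (fun y : int => f y) x
      = ∑ y : int, A x y * f y := by
    simp only [Matrix.mulVec, dotProduct, minusTwistedLapMatrix, Matrix.of_apply, hA]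
  rw [h1, Finset.sum_coe_sort int (fun y => A x y * f y)]
  rw [Finset.sum_subset (Finset.subset_univ int) (fun y _ hy => by rw [hf y hy, mul_zero])]
  rw [twLap, ← Finset.add_sum_erase _ _ (Finset.mem_univ (x : α))]
  have h2 : ∑ y ∈ Finset.univ.erase (x : α), A x y * f y
      = ∑ y : α, if H.Adj x y then -(τ x y * C x y) * f y else 0 := by
    rw [← Finset.add_sum_erase Finset.univ
      (fun y : α => if H.Adj x y then -(τ x y * C x y) * f y else 0) (Finset.mem_univ (x : α))]
    rw [if_neg (H.loopless.irrefl _), zero_add]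
    refine Finset.sum_congr rfl fun y hy => ?_
    have hne : (x : α) ≠ y := fun h => (Finset.mem_erase.mp hy).1 h.symm
    simp only [hA, if_neg hne]
    split_ifs <;> simp
  rw [h2]
  simp only [hA, if_true]
  rw [Finset.sum_mul, ← Finset.sum_add_distrib]
  refine Finset.sum_congr rfl fun y _ => ?_
  split_ifs <;> ring

theorem twLap_unique {α : Type*} [Fintype α] (H : SimpleGraph α) (hconn : H.Connected)
    (C τ : α → α → ℝ) (int : Finset α) (b : α) (hb : b ∉ int)
    (hC : ∀ x y, H.Adj x y → 0 < C x y) (hτ : ∀ x y, H.Adj x y → τ x y = 1 ∨ τ x y = -1)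
    (f : α → ℝ) (hf : ∀ x, x ∉ int → f x = 0) (hL : ∀ x ∈ int, twLap H C τ f x = 0) :
    ∀ x, f x = 0 := by
  classical
  obtain ⟨m, -, hm⟩ := Finset.exists_max_image Finset.univ (fun x => |f x|) ⟨b, Finset.mem_univ b⟩
  have hm' : ∀ x, |f x| ≤ |f m| := fun x => hm x (Finset.mem_univ x)
  suffices h0 : |f m| = 0 by
    intro x
    exact abs_nonpos_iff.mp (h0 ▸ hm' x)
  by_contra hne
  have step : ∀ x y, H.Adj x y → |f x| = |f m| → |f y| = |f m| := by
    intro x y hxy hx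
    have hxi : x ∈ int := by
      by_contra h
      rw [hf x h, abs_zero] at hx
      exact hne hx.symm
    have h := hL x hxi
    rw [twLap] at h
    -- multiply by f x
    have h' : ∑ z : α, (if H.Adj x z then C x z * (f x - τ x z * f z) * f x else 0) = 0 := by
      have h0 := congrArg (fun t => t * f x) h
      simp only [zero_mul, Finset.sum_mul] at h0
      refine Eq.trans ?_ h0
      refine Finset.sum_congr rfl fun z _ => ?_
      split_ifs <;> simp
    have key : ∀ z, H.Adj x z → τ x z * f z * f x ≤ |f z| * |f x| := by
      intro z hz
      rw [← abs_mul]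
      rcases hτ x z hz with h | h <;> rw [h]
      · rw [one_mul]; exact le_abs_self _
      · have := neg_abs_le (f z * f x); linarith
    have hsq : f x * f x = |f x| * |f x| := (abs_mul_abs_self _).symm
    have hnn : ∀ z ∈ Finset.univ,
        0 ≤ (if H.Adj x z then C x z * (f x - τ x z * f z) * f x else 0) := by
      intro z _
      split_ifs with hz
      · rw [mul_assoc]
        refine mul_nonneg (hC x z hz).le ?_
        have h1 := key z hz
        have h2 := mul_le_mul_of_nonneg_right (hm' z) (abs_nonneg (f x))
        rw [hx] at h1 h2 hsq
        nlinarith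
      · exact le_rfl
    have h3 := (Finset.sum_eq_zero_iff_of_nonneg hnn).mp h' y (Finset.mem_univ y)
    rw [if_pos hxy, mul_assoc] at h3
    have h4 : (f x - τ x y * f y) * f x = 0 :=
      (mul_eq_zero.mp h3).resolve_left (hC x y hxy).ne'
    have h1 := key y hxy
    have hpos : 0 < |f m| := lt_of_le_of_ne (abs_nonneg _) (Ne.symm hne)
    rw [hx] at h1 hsq
    have h5 : |f m| * |f m| ≤ |f y| * |f m| := by nlinarith
    exact le_antisymm (hm' y) (le_of_mul_le_mul_right h5 hpos)
  have hreach : ∀ y, H.Reachable m y → |f y| = |f m| := by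
    intro y hy
    obtain ⟨w⟩ := hy
    have : ∀ u v (w : H.Walk u v), |f u| = |f m| → |f v| = |f m| := by
      intro u v w
      induction w with
      | nil => exact id
      | cons h _ ih => exact fun hu => ih (step _ _ h hu)
    exact this m y w rfl
  have := hreach b (hconn.preconnected m b)
  rw [hf b hb, abs_zero] at this
  exact hne this.symm

theorem twLap_isUnit {α : Type*} [Fintype α] (H : SimpleGraph α) (hconn : H.Connected)
    (C τ : α → α → ℝ) (int : Finset α) (b : α) (hb : b ∉ int)
    (hC : ∀ x y, H.Adj x y → 0 < C x y) (hτ : ∀ x y, H.Adj x y → τ x y = 1 ∨ τ x y = -1) :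
    IsUnit (minusTwistedLapMatrix H C τ int) := by
  classical
  rw [← Matrix.mulVec_injective_iff_isUnit]
  rw [← Matrix.coe_mulVecLin, ← LinearMap.ker_eq_bot, LinearMap.ker_eq_bot']
  intro g hg
  rw [Matrix.mulVecLin_apply] at hg
  let f : α → ℝ := fun x => if h : x ∈ int then g ⟨x, h⟩ else 0
  have hfg : (fun y : int => f y) = g := by
    funext y; simp [f]
  have hf : ∀ x, x ∉ int → f x = 0 := fun x hx => by simp [f, hx]
  have h0 := twLap_unique H hconn C τ int b hb hC hτ f hf (fun x hx => by
    have := twLap_mulVec H C τ int f hf ⟨x, hx⟩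
    rw [hfg, hg] at this
    exact this.symm)
  rw [← hfg]
  funext y
  exact h0 y

theorem twistedGreen_eq {α : Type*} [Fintype α] (H : SimpleGraph α)
    (C τ : α → α → ℝ) (int : Finset α) (hU : IsUnit (minusTwistedLapMatrix H C τ int))
    (f : α → ℝ) (hf : ∀ x, x ∉ int → f x = 0) (y : int)
    (hL : ∀ x ∈ int, twLap H C τ f x = if x = y then 1 else 0) (x : int) :
    twistedGreen H C τ int x y = f x := by
  have hd := (Matrix.isUnit_iff_isUnit_det _).mp hU
  have h1 : (minusTwistedLapMatrix H C τ int).mulVec (fun y : int => f y) = Pi.single y 1 := by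
    funext z
    rw [twLap_mulVec H C τ int f hf z, hL z z.2, Pi.single_apply]
    simp only [Subtype.ext_iff]
  have h2 := congrArg (fun v => (twistedGreen H C τ int).mulVec v x) h1
  simp only [Matrix.mulVec_mulVec, twistedGreen] at h2
  rw [Matrix.nonsing_inv_mul _ hd, Matrix.one_mulVec, Matrix.mulVec_single_one] at h2
  rw [twistedGreen]
  exact h2.symm

theorem twistedGreen_exists {α : Type*} [Fintype α] (H : SimpleGraph α)
    (C τ : α → α → ℝ) (int : Finset α) (hU : IsUnit (minusTwistedLapMatrix H C τ int))
    (y : int) :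
    ∃ f : α → ℝ, (∀ x, x ∉ int → f x = 0) ∧
      ∀ x ∈ int, twLap H C τ f x = if x = y then 1 else 0 := by
  classical
  have hd := (Matrix.isUnit_iff_isUnit_det _).mp hU
  let g : int → ℝ := (minusTwistedLapMatrix H C τ int)⁻¹.mulVec (Pi.single y 1)
  let f : α → ℝ := fun x => if h : x ∈ int then g ⟨x, h⟩ else 0
  have hfg : (fun y : int => f y) = g := by
    funext y; simp [f]
  have hf : ∀ x, x ∉ int → f x = 0 := fun x hx => by simp [f, hx]
  refine ⟨f, hf, fun x hx => ?_⟩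
  rw [← twLap_mulVec H C τ int f hf ⟨x, hx⟩, hfg]
  simp only [g, Matrix.mulVec_mulVec]
  rw [Matrix.mul_nonsing_inv _ hd, Matrix.one_mulVec, Pi.single_apply]
  simp only [Subtype.ext_iff]

section Sub

variable {V : Type*} {G : SimpleGraph V} {N : ℕ} {o : Sym2 V → V × V}

theorem o_adj (ho : ∀ e : Sym2 V, e ∈ G.edgeSet → s((o e).1, (o e).2) = e) (e : G.edgeSet) :
    G.Adj (o e.1).1 (o e.1).2 := by
  have := ho e.1 e.2
  have h2 := e.2
  rw [← this] at h2
  exact h2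

theorem pathVert_zero (e : G.edgeSet) : pathVert G N o e 0 = Sum.inl (o e.1).1 := by
  simp [pathVert]

theorem pathVert_last (hN : 1 ≤ N) (e : G.edgeSet) :
    pathVert G N o e N = Sum.inl (o e.1).2 := by
  have : N ≠ 0 := by omega
  simp [pathVert, this]

theorem pathVert_mid (e : G.edgeSet) (k : Fin (N - 1)) :
    pathVert G N o e (k + 1) = Sum.inr (e, k) := by
  have : ¬ N ≤ (k : ℕ) + 1 := by omega
  simp [pathVert, this]

/-- Every index at most `N` is of one of three kinds. -/
theorem idx_cases (k : ℕ) (hk : k ≤ N) :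
    k = 0 ∨ k = N ∨ ∃ i : Fin (N - 1), k = i + 1 := by
  by_cases h0 : k = 0
  · exact Or.inl h0
  by_cases h1 : k = N
  · exact Or.inr (Or.inl h1)
  · exact Or.inr (Or.inr ⟨⟨k - 1, by omega⟩, by simp; omega⟩)

theorem pathVert_adj (hN : 1 ≤ N)
    (ho : ∀ e : Sym2 V, e ∈ G.edgeSet → s((o e).1, (o e).2) = e) (e : G.edgeSet) (j : ℕ)
    (hj : j < N) :
    (subGraph G N o).Adj (pathVert G N o e j) (pathVert G N o e (j + 1)) := by
  change subAdj G N o _ _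
  have ha := o_adj ho e
  rcases idx_cases j hj.le with h | h | ⟨i, hi⟩
  · rcases idx_cases (j + 1) hj with h' | h' | ⟨i', hi'⟩
    · omega
    · rw [h', h, pathVert_zero, pathVert_last hN]
      exact ⟨by omega, ha⟩
    · rw [hi', h, pathVert_zero, pathVert_mid]
      exact Or.inl ⟨rfl, by omega⟩
  · omega
  · rcases idx_cases (j + 1) hj with h' | h' | ⟨i', hi'⟩
    · omega
    · rw [h', hi, pathVert_mid, pathVert_last hN]
      exact Or.inr ⟨rfl, by omega⟩
    · rw [hi', hi, pathVert_mid, pathVert_mid]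
      exact ⟨rfl, Or.inl (by omega)⟩

theorem pathVert_reach (hN : 1 ≤ N)
    (ho : ∀ e : Sym2 V, e ∈ G.edgeSet → s((o e).1, (o e).2) = e) (e : G.edgeSet) (j : ℕ)
    (hj : j ≤ N) :
    (subGraph G N o).Reachable (Sum.inl (o e.1).1) (pathVert G N o e j) := by
  induction j with
  | zero => rw [pathVert_zero]
  | succ j ih => exact (ih (by omega)).trans (pathVert_adj hN ho e j (by omega)).reachable

theorem subGraph_connected (hN : 1 ≤ N)
    (ho : ∀ e : Sym2 V, e ∈ G.edgeSet → s((o e).1, (o e).2) = e) (hconn : G.Connected) :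
    (subGraph G N o).Connected := by
  have hadj : ∀ x y, G.Adj x y →
      (subGraph G N o).Reachable (Sum.inl x : SubVert G N) (Sum.inl y) := by
    intro x y hxy
    have h := pathVert_reach hN ho ⟨s(x, y), hxy⟩ N le_rfl
    rw [pathVert_last hN] at h
    have h2 := ho s(x, y) hxy
    rcases Sym2.eq_iff.mp h2 with ⟨h3, h4⟩ | ⟨h3, h4⟩
    · simp only [h3, h4] at h; exact h
    · simp only [h3, h4] at h; exact h.symm
  have hll : ∀ x y, (subGraph G N o).Reachable (Sum.inl x : SubVert G N) (Sum.inl y) := by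
    intro x y
    obtain ⟨w⟩ := hconn.preconnected x y
    induction w with
    | nil => exact SimpleGraph.Reachable.refl _
    | cons h _ ih => exact (hadj _ _ h).trans ih
  obtain ⟨v0⟩ := hconn.nonempty
  have hall : ∀ v, (subGraph G N o).Reachable (Sum.inl v0 : SubVert G N) v := by
    rintro (x | ⟨e, k⟩)
    · exact hll _ _
    · refine (hll v0 (o e.1).1).trans ?_
      rw [← pathVert_mid (o := o)]
      exact pathVert_reach hN ho e _ (by omega)
  have : Nonempty (SubVert G N) := ⟨Sum.inl v0⟩
  exact ⟨fun u v => (hall u).symm.trans (hall v)⟩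

/-- Neighbours of a new vertex. -/
theorem adj_inr_iff (hN : 1 ≤ N) (e : G.edgeSet) (k : Fin (N - 1)) (v : SubVert G N) :
    (subGraph G N o).Adj (Sum.inr (e, k)) v ↔
      v = pathVert G N o e k ∨ v = pathVert G N o e (k + 2) := by
  change subAdj G N o _ _ ↔ _
  have hk := k.2
  constructor
  · rcases v with x | ⟨e', k'⟩
    · rintro (⟨h1, h2⟩ | ⟨h1, h2⟩)
      · left; rw [h2, pathVert_zero, h1]
      · right
        rw [show (k : ℕ) + 2 = N by omega, pathVert_last hN, h1]
    · rintro ⟨rfl, h | h⟩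
      · right
        rw [show (k : ℕ) + 2 = k' + 1 by omega, pathVert_mid]
      · left
        rw [← h, pathVert_mid]
  · rintro (rfl | rfl)
    · rcases idx_cases (N := N) (k : ℕ) (by omega) with h | h | ⟨i, hi⟩
      · rw [h, pathVert_zero]; exact Or.inl ⟨rfl, h⟩
      · omega
      · rw [hi, pathVert_mid]; exact ⟨rfl, Or.inr hi.symm⟩
    · rcases idx_cases (N := N) ((k : ℕ) + 2) (by omega) with h | h | ⟨i, hi⟩
      · omega
      · rw [h, pathVert_last hN]; exact Or.inr ⟨rfl, by omega⟩
      · rw [hi, pathVert_mid]; exact ⟨rfl, Or.inl (by omega)⟩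

theorem pathVert_ne (hN : 1 ≤ N)
    (ho : ∀ e : Sym2 V, e ∈ G.edgeSet → s((o e).1, (o e).2) = e)
    (e : G.edgeSet) (k : Fin (N - 1)) :
    pathVert G N o e k ≠ pathVert G N o e (k + 2) := by
  have hk := k.2
  have hne := (o_adj ho e).ne
  rcases idx_cases (N := N) (k : ℕ) (by omega) with h | h | ⟨i, hi⟩ <;>
  rcases idx_cases (N := N) ((k : ℕ) + 2) (by omega) with h' | h' | ⟨i', hi'⟩ <;>
  try omega
  · rw [h', h, pathVert_zero, pathVert_last hN]
    simpa using hne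
  · rw [hi', h, pathVert_zero, pathVert_mid]; simp
  · rw [h', hi, pathVert_mid, pathVert_last hN]; simp
  · rw [hi', hi, pathVert_mid, pathVert_mid]
    simp only [ne_eq, Sum.inr.injEq, Prod.mk.injEq, true_and]
    intro hh
    rw [hh] at hi
    omega

/-- The neighbour of `x` in the subdivision in direction of `y`. -/
noncomputable def nbr (G : SimpleGraph V) (N : ℕ) (o : Sym2 V → V × V) (x y : V) : SubVert G N :=
  if h : G.Adj x y then
    (if (o s(x, y)).1 = x then pathVert G N o ⟨s(x, y), h⟩ 1
      else pathVert G N o ⟨s(x, y), h⟩ (N - 1))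
  else Sum.inl x

theorem nbr_cases (ho : ∀ e : Sym2 V, e ∈ G.edgeSet → s((o e).1, (o e).2) = e)
    {x y : V} (h : G.Adj x y) :
    ((o s(x, y)).1 = x ∧ (o s(x, y)).2 = y ∧ nbr G N o x y = pathVert G N o ⟨s(x, y), h⟩ 1) ∨
    ((o s(x, y)).1 = y ∧ (o s(x, y)).2 = x ∧
      nbr G N o x y = pathVert G N o ⟨s(x, y), h⟩ (N - 1)) := by
  rcases Sym2.eq_iff.mp (ho s(x, y) h) with ⟨h3, h4⟩ | ⟨h3, h4⟩
  · left; exact ⟨h3, h4, by simp [nbr, h, h3]⟩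
  · right; exact ⟨h3, h4, by simp [nbr, h, h3, h.ne']⟩

theorem sum_nbr [Fintype V] [Fintype (SubVert G N)] (hN : 1 ≤ N)
    (ho : ∀ e : Sym2 V, e ∈ G.edgeSet → s((o e).1, (o e).2) = e)
    (x : V) (F : SubVert G N → ℝ) :
    (∑ v : SubVert G N, if (subGraph G N o).Adj (Sum.inl x) v then F v else 0) =
      ∑ y : V, if G.Adj x y then F (nbr G N o x y) else 0 := by
  rw [← Finset.sum_filter, ← Finset.sum_filter]
  symm
  refine Finset.sum_bij (fun y _ => nbr G N o x y) ?_ ?_ ?_ (fun _ _ => rfl)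
  · intro y hy
    have hxy : G.Adj x y := (Finset.mem_filter.mp hy).2
    refine Finset.mem_filter.mpr ⟨Finset.mem_univ _, ?_⟩
    rcases nbr_cases (N := N) ho hxy with ⟨h1, h2, h3⟩ | ⟨h1, h2, h3⟩
    · have := pathVert_adj hN ho ⟨s(x, y), hxy⟩ 0 (by omega)
      rw [pathVert_zero] at this
      simp only [h1] at this
      rw [h3]; exact this
    · have := pathVert_adj hN ho ⟨s(x, y), hxy⟩ (N - 1) (by omega)
      rw [Nat.sub_add_cancel hN, pathVert_last hN] at this
      simp only [h2] at this
      rw [h3]; exact this.symm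
  · intro y hy y' hy' heq
    have hxy : G.Adj x y := (Finset.mem_filter.mp hy).2
    have hxy' : G.Adj x y' := (Finset.mem_filter.mp hy').2
    have key : ∀ z (hz : G.Adj x z), (N = 1 ∧ nbr G N o x z = Sum.inl z) ∨
        (N ≠ 1 ∧ ∃ i, nbr G N o x z = Sum.inr (⟨s(x, z), hz⟩, i)) := by
      intro z hz
      by_cases h1 : N = 1
      · left
        refine ⟨h1, ?_⟩
        rcases nbr_cases (N := N) ho hz with ⟨h2, h3, h4⟩ | ⟨h2, h3, h4⟩
        · rw [h4]; conv_lhs => rw [← h1]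
          subst h1
          rw [pathVert_last hN]; simp [h3]
        · rw [h4]; subst h1
          rw [pathVert_zero]; simp [h2]
      · right
        refine ⟨h1, ?_⟩
        rcases nbr_cases (N := N) ho hz with ⟨h2, h3, h4⟩ | ⟨h2, h3, h4⟩
        · exact ⟨⟨0, by omega⟩, by rw [h4, ← pathVert_mid (o := o)]⟩
        · exact ⟨⟨N - 2, by omega⟩, by
            rw [h4, ← pathVert_mid (o := o)]; congr 1; simp; omega⟩
    rcases key y hxy with ⟨h1, h2⟩ | ⟨h1, i, h2⟩ <;>
    rcases key y' hxy' with ⟨h1', h2'⟩ | ⟨h1', i', h2'⟩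
    · exact Sum.inl.inj (h2.symm.trans (heq.trans h2'))
    · exact absurd h1 h1'
    · exact absurd h1' h1
    · have := Sum.inr.inj (h2.symm.trans (heq.trans h2'))
      have h5 := congrArg (fun p => (p.1 : Sym2 V)) this
      exact Sym2.congr_right.mp h5
  · intro v hv
    have hv : subAdj G N o (Sum.inl x) v := (Finset.mem_filter.mp hv).2
    have fin : ∀ y, G.Adj x y → nbr G N o x y = v →
        ∃ a, ∃ (_ : a ∈ Finset.univ.filter (fun y => G.Adj x y)), nbr G N o x a = v :=
      fun y hy h => ⟨y, Finset.mem_filter.mpr ⟨Finset.mem_univ _, hy⟩, h⟩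
    rcases v with y | ⟨e, k⟩
    · obtain ⟨h1, hz⟩ := hv
      refine fin y hz ?_
      rcases nbr_cases (N := N) ho hz with ⟨h2, h3, h4⟩ | ⟨h2, h3, h4⟩
      · rw [h4]; subst h1
        rw [pathVert_last hN]; simp [h3]
      · rw [h4]; subst h1
        rw [pathVert_zero]; simp [h2]
    · have ha := o_adj ho e
      have hoe := ho e.1 e.2
      rcases hv with ⟨h1, h2⟩ | ⟨h1, h2⟩
      · have hz : G.Adj x (o e.1).2 := by rw [h1]; exact ha
        have hee : s(x, (o e.1).2) = e.1 := by rw [h1]; exact hoe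
        have hee' : (⟨s(x, (o e.1).2), hz⟩ : G.edgeSet) = e := Subtype.ext hee
        refine fin (o e.1).2 hz ?_
        rcases nbr_cases (N := N) ho hz with ⟨h3, h4, h5⟩ | ⟨h3, h4, h5⟩
        · rw [h5, hee', ← pathVert_mid (o := o), h2]
        · rw [hee] at h3; exact absurd h3 ha.ne
      · have hz : G.Adj x (o e.1).1 := by rw [h1]; exact ha.symm
        have hee : s(x, (o e.1).1) = e.1 := by rw [h1, Sym2.eq_swap]; exact hoe
        have hee' : (⟨s(x, (o e.1).1), hz⟩ : G.edgeSet) = e := Subtype.ext hee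
        refine fin (o e.1).1 hz ?_
        rcases nbr_cases (N := N) ho hz with ⟨h3, h4, h5⟩ | ⟨h3, h4, h5⟩
        · rw [hee] at h4; exact absurd h4 ha.ne'
        · have hk := k.2
          rw [h5, hee', ← pathVert_mid (o := o), h2]; congr 1; omega

/-- Partial products of the gauge along the path. -/
noncomputable def gaugeProd (G : SimpleGraph V) (N : ℕ) (o : Sym2 V → V × V)
    (σ' : SubVert G N → SubVert G N → ℝ) (e : G.edgeSet) (k : ℕ) : ℝ :=
  ∏ j ∈ Finset.range k, σ' (pathVert G N o e j) (pathVert G N o e (j + 1))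

/-- Interpolated value at index `k` on the path of `e`. -/
noncomputable def interp (G : SimpleGraph V) (N : ℕ) (o : Sym2 V → V × V)
    (σ' : SubVert G N → SubVert G N → ℝ) (f : V → ℝ) (e : G.edgeSet) (k : ℕ) : ℝ :=
  gaugeProd G N o σ' e k * ((1 - k / N) * f (o e.1).1
    + k / N * (gaugeProd G N o σ' e N * f (o e.1).2))

/-- Twisted harmonic extension to the subdivision. -/
noncomputable def hext (G : SimpleGraph V) (N : ℕ) (o : Sym2 V → V × V)
    (σ' : SubVert G N → SubVert G N → ℝ) (f : V → ℝ) : SubVert G N → ℝ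
  | Sum.inl x => f x
  | Sum.inr (e, k) => interp G N o σ' f e (k + 1)

theorem gaugeProd_sq (hN : 1 ≤ N)
    (ho : ∀ e : Sym2 V, e ∈ G.edgeSet → s((o e).1, (o e).2) = e)
    (σ' : SubVert G N → SubVert G N → ℝ)
    (hσ'pm : ∀ u v, (subGraph G N o).Adj u v → σ' u v = 1 ∨ σ' u v = -1)
    (e : G.edgeSet) (k : ℕ) (hk : k ≤ N) :
    gaugeProd G N o σ' e k * gaugeProd G N o σ' e k = 1 := by
  rw [gaugeProd, ← Finset.prod_mul_distrib]
  refine Finset.prod_eq_one fun j hj => ?_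
  have hj := Finset.mem_range.mp hj
  rcases hσ'pm _ _ (pathVert_adj hN ho e j (by omega)) with h | h <;> rw [h] <;> norm_num

theorem hext_pathVert (hN : 1 ≤ N)
    (ho : ∀ e : Sym2 V, e ∈ G.edgeSet → s((o e).1, (o e).2) = e)
    (σ' : SubVert G N → SubVert G N → ℝ)
    (hσ'pm : ∀ u v, (subGraph G N o).Adj u v → σ' u v = 1 ∨ σ' u v = -1)
    (f : V → ℝ) (e : G.edgeSet) (k : ℕ) (hk : k ≤ N) :
    hext G N o σ' f (pathVert G N o e k) = interp G N o σ' f e k := by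
  rcases idx_cases k hk with h | h | ⟨i, h⟩
  · rw [h, pathVert_zero]; simp [hext, interp, gaugeProd]
  · have hN0 : (N : ℝ) ≠ 0 := by positivity
    have hs := gaugeProd_sq hN ho σ' hσ'pm e N le_rfl
    rw [h, pathVert_last hN]; simp only [hext, interp]
    rw [div_self hN0]
    linear_combination (-f (o e.1).2) * hs
  · rw [h, pathVert_mid]; rfl

theorem gaugeProd_succ (σ' : SubVert G N → SubVert G N → ℝ) (e : G.edgeSet) (k : ℕ) :
    gaugeProd G N o σ' e (k + 1) = gaugeProd G N o σ' e k *
      σ' (pathVert G N o e k) (pathVert G N o e (k + 1)) :=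
  Finset.prod_range_succ _ _

theorem twLap_hext_inr [Fintype (SubVert G N)] (hN : 1 ≤ N)
    (ho : ∀ e : Sym2 V, e ∈ G.edgeSet → s((o e).1, (o e).2) = e)
    (C : V → V → ℝ)
    (σ' : SubVert G N → SubVert G N → ℝ) (hσ'sym : ∀ u v, σ' u v = σ' v u)
    (hσ'pm : ∀ u v, (subGraph G N o).Adj u v → σ' u v = 1 ∨ σ' u v = -1)
    (f : V → ℝ) (e : G.edgeSet) (k : Fin (N - 1)) :
    twLap (subGraph G N o) (subC o C) σ' (hext G N o σ' f) (Sum.inr (e, k)) = 0 := by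
  have hk := k.2
  have hN0 : (N : ℝ) ≠ 0 := by positivity
  rw [twLap, ← Finset.sum_filter]
  have hfil : (Finset.univ.filter fun v => (subGraph G N o).Adj (Sum.inr (e, k)) v)
      = {pathVert G N o e k, pathVert G N o e (k + 2)} := by
    ext v
    simp only [Finset.mem_filter, Finset.mem_univ, true_and, Finset.mem_insert,
      Finset.mem_singleton]
    exact adj_inr_iff hN e k v
  rw [hfil, Finset.sum_pair (pathVert_ne hN ho e k)]
  simp only [subC]
  rw [← mul_add]
  refine mul_eq_zero_of_right _ ?_
  have hmid := pathVert_mid (o := o) e k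
  rw [← hmid, hext_pathVert hN ho σ' hσ'pm f e _ (by omega),
    hext_pathVert hN ho σ' hσ'pm f e _ (by omega), hext_pathVert hN ho σ' hσ'pm f e _ (by omega)]
  rw [hσ'sym (pathVert G N o e (k + 1)) (pathVert G N o e k)]
  have s1 := gaugeProd_succ (o := o) σ' e k
  have s2 := gaugeProd_succ (o := o) σ' e (k + 1)
  have q0 := gaugeProd_sq hN ho σ' hσ'pm e k (by omega)
  have q1 := gaugeProd_sq hN ho σ' hσ'pm e (k + 1) (by omega)
  have q2 := gaugeProd_sq hN ho σ' hσ'pm e (k + 2) (by omega)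
  have e1 : σ' (pathVert G N o e k) (pathVert G N o e (k + 1)) * gaugeProd G N o σ' e k
      = gaugeProd G N o σ' e (k + 1) := by rw [s1]; ring
  have e2 : σ' (pathVert G N o e (k + 1)) (pathVert G N o e (k + 2)) * gaugeProd G N o σ' e (k + 2)
      = gaugeProd G N o σ' e (k + 1) := by
    have e3 : gaugeProd G N o σ' e (k + 2) = gaugeProd G N o σ' e (k + 1) *
      σ' (pathVert G N o e (k + 1)) (pathVert G N o e (k + 2)) := s2
    have t2 : σ' (pathVert G N o e (k + 1)) (pathVert G N o e (k + 2)) *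
        σ' (pathVert G N o e (k + 1)) (pathVert G N o e (k + 2)) = 1 := by
      rcases hσ'pm _ _ (pathVert_adj hN ho e (k + 1) (by omega)) with h | h <;>
        rw [h] <;> norm_num
    rw [e3]
    linear_combination gaugeProd G N o σ' e (k + 1) * t2
  simp only [interp]
  rw [← mul_assoc (σ' _ _) (gaugeProd _ _ _ _ _ _), e1, ← mul_assoc (σ' _ _) (gaugeProd _ _ _ _ _ _), e2]
  push_cast
  ring

theorem twLap_hext_inl [Fintype V] [Fintype (SubVert G N)] (hN : 1 ≤ N)
    (ho : ∀ e : Sym2 V, e ∈ G.edgeSet → s((o e).1, (o e).2) = e)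
    (C : V → V → ℝ) (hCsym : ∀ x y, C x y = C y x)
    (σ : V → V → ℝ) (hσsym : ∀ x y, σ x y = σ y x)
    (σ' : SubVert G N → SubVert G N → ℝ) (hσ'sym : ∀ u v, σ' u v = σ' v u)
    (hσ'pm : ∀ u v, (subGraph G N o).Adj u v → σ' u v = 1 ∨ σ' u v = -1)
    (hprod : ∀ e : G.edgeSet, gaugeProd G N o σ' e N = σ (o e.1).1 (o e.1).2)
    (f : V → ℝ) (x : V) :
    twLap (subGraph G N o) (subC o C) σ' (hext G N o σ' f) (Sum.inl x) = twLap G C σ f x := by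
  have hN0 : (N : ℝ) ≠ 0 := by positivity
  rw [twLap, sum_nbr hN ho x (fun v => subC o C (Sum.inl x) v *
    (hext G N o σ' f (Sum.inl x) - σ' (Sum.inl x) v * hext G N o σ' f v)), twLap]
  refine Finset.sum_congr rfl fun y _ => ?_
  split_ifs with hxy
  swap
  · rfl
  have hC : subC o C (Sum.inl x) (nbr G N o x y) = N * C x y := by
    have hCe : C (o s(x, y)).1 (o s(x, y)).2 = C x y := by
      rcases nbr_cases (N := N) ho hxy with ⟨h1, h2, -⟩ | ⟨h1, h2, -⟩
      · rw [h1, h2]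
      · rw [h1, h2, hCsym]
    rcases nbr_cases (N := N) ho hxy with ⟨h1, h2, h3⟩ | ⟨h1, h2, h3⟩
    · rw [h3]
      rcases idx_cases (N := N) 1 hN with h | h | ⟨i, h⟩
      · omega
      · have := pathVert_last (o := o) hN ⟨s(x, y), hxy⟩
        rw [← h] at this ⊢
        subst h
        rw [this]; simp only [subC, h2]
      · rw [(congrArg (pathVert G N o ⟨s(x, y), hxy⟩) h).trans (pathVert_mid _ i)]
        simp only [subC, hCe]
    · rw [h3]
      rcases idx_cases (N := N) (N - 1) (by omega) with h | h | ⟨i, h⟩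
      · rw [(congrArg (pathVert G N o ⟨s(x, y), hxy⟩) h).trans (pathVert_zero _)]
        simp only [subC, h1]
      · omega
      · rw [(congrArg (pathVert G N o ⟨s(x, y), hxy⟩) h).trans (pathVert_mid _ i)]
        simp only [subC, hCe]
  rw [hC]
  have hx : hext G N o σ' f (Sum.inl x) = f x := rfl
  rw [hx]
  suffices h : (N : ℝ) * (f x - σ' (Sum.inl x) (nbr G N o x y) * hext G N o σ' f (nbr G N o x y))
      = f x - σ x y * f y by
    rw [mul_comm (N : ℝ), mul_assoc, h]
  have hp := hprod ⟨s(x, y), hxy⟩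
  rcases nbr_cases (N := N) ho hxy with ⟨h1, h2, h3⟩ | ⟨h1, h2, h3⟩
  · simp only [h1, h2] at hp
    rw [h3, hext_pathVert hN ho σ' hσ'pm f _ _ hN]
    have hz := pathVert_zero (N := N) (o := o) ⟨s(x, y), hxy⟩
    simp only [h1] at hz
    have q1 := gaugeProd_sq hN ho σ' hσ'pm ⟨s(x, y), hxy⟩ 1 hN
    have s1 : gaugeProd G N o σ' ⟨s(x, y), hxy⟩ 1
        = σ' (Sum.inl x) (pathVert G N o ⟨s(x, y), hxy⟩ 1) := by
      simp [gaugeProd, hz]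
    simp only [interp, h1, h2, hp]
    rw [← s1, ← mul_assoc (gaugeProd _ _ _ _ _ _) (gaugeProd _ _ _ _ _ _), q1]
    push_cast
    field_simp
    ring
  · simp only [h1, h2] at hp
    rw [h3, hext_pathVert hN ho σ' hσ'pm f _ _ (by omega)]
    have hz := pathVert_last (o := o) hN ⟨s(x, y), hxy⟩
    simp only [h2] at hz
    have qN := gaugeProd_sq hN ho σ' hσ'pm ⟨s(x, y), hxy⟩ N le_rfl
    have s1 := gaugeProd_succ (o := o) σ' ⟨s(x, y), hxy⟩ (N - 1)
    rw [Nat.sub_add_cancel hN, hz, hσ'sym, hp, mul_comm] at s1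
    rw [hp] at qN
    simp only [interp, h1, h2, hp]
    rw [← mul_assoc (σ' _ _) (gaugeProd _ _ _ _ _ _), ← s1, Nat.cast_sub hN, hσsym x y]
    push_cast
    field_simp
    linear_combination (-(N - 1) * f x) * qN

end Sub

/-- Subdivision invariance of the twisted Green's function: if `σ^(N)` is any gauge
field on the `N`-fold subdivision `𝒢^(N)` which carries the value `1` on all `N`
subdivided edges of each edge `e` with `σ(e) = 1`, and the value `−1` on exactly one of
the `N` subdivided edges (and `1` on the other `N−1`) of each edge `e` with
`σ(e) = −1`, then the `σ^(N)`-twisted Green's function of `𝒢^(N)` with zero boundary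
conditions on `V_∂`, restricted to `V × V`, coincides with the `σ`-twisted Green's
function of `𝒢`. -/
theorem subdivision_twistedGreen_invariance {V : Type*} [Fintype V] [DecidableEq V]
    (G : SimpleGraph V) [DecidableRel G.Adj] (hconn : G.Connected)
    (Vi : Finset V) (hVi : Vi.Nonempty) (hVb : (Viᶜ : Finset V).Nonempty)
    (C : V → V → ℝ) (hCsym : ∀ x y, C x y = C y x)
    (hCpos : ∀ x y, G.Adj x y → 0 < C x y)
    (σ : V → V → ℝ) (hσsym : ∀ x y, σ x y = σ y x)
    (hσpm : ∀ x y, G.Adj x y → σ x y = 1 ∨ σ x y = -1)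
    (N : ℕ) (hN : 1 ≤ N)
    (o : Sym2 V → V × V) (ho : ∀ e : Sym2 V, e ∈ G.edgeSet → s((o e).1, (o e).2) = e)
    (σ' : SubVert G N → SubVert G N → ℝ)
    (hσ'sym : ∀ u v, σ' u v = σ' v u)
    (hσ'pm : ∀ u v, (subGraph G N o).Adj u v → σ' u v = 1 ∨ σ' u v = -1)
    (hσ'one : ∀ e : G.edgeSet, σ (o e.1).1 (o e.1).2 = 1 →
      ∀ j < N, σ' (pathVert G N o e j) (pathVert G N o e (j + 1)) = 1)
    (hσ'negone : ∀ e : G.edgeSet, σ (o e.1).1 (o e.1).2 = -1 →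
      ∃ j₀ < N, σ' (pathVert G N o e j₀) (pathVert G N o e (j₀ + 1)) = -1 ∧
        ∀ j < N, j ≠ j₀ → σ' (pathVert G N o e j) (pathVert G N o e (j + 1)) = 1) :
    ∀ (x y : V) (hx : x ∈ Vi) (hy : y ∈ Vi),
      twistedGreen (subGraph G N o) (subC o C) σ' (subInterior G N Vi)
          ⟨Sum.inl x, by
            refine Finset.mem_filter.mpr ⟨Finset.mem_univ _, ?_⟩
            rintro z hz
            exact (Sum.inl.inj hz) ▸ hx⟩
          ⟨Sum.inl y, by
            refine Finset.mem_filter.mpr ⟨Finset.mem_univ _, ?_⟩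
            rintro z hz
            exact (Sum.inl.inj hz) ▸ hy⟩ =
        twistedGreen G C σ Vi ⟨x, hx⟩ ⟨y, hy⟩ := by
  intro x y hx hy
  obtain ⟨b, hb⟩ := hVb
  have hb : b ∉ Vi := Finset.mem_compl.mp hb
  have hU := twLap_isUnit G hconn C σ Vi b hb hCpos hσpm
  have hCpos' : ∀ u v, (subGraph G N o).Adj u v → 0 < subC o C u v := by
    have hNpos : (0 : ℝ) < N := by exact_mod_cast hN
    rintro (u | ⟨e, k⟩) (v | ⟨e', k'⟩) h
    · exact mul_pos hNpos (hCpos _ _ h.2)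
    · exact mul_pos hNpos (hCpos _ _ (o_adj ho e'))
    · exact mul_pos hNpos (hCpos _ _ (o_adj ho e))
    · exact mul_pos hNpos (hCpos _ _ (o_adj ho e))
  have hint : ∀ v : V, (Sum.inl v : SubVert G N) ∈ subInterior G N Vi ↔ v ∈ Vi := by
    intro v
    rw [subInterior, Finset.mem_filter]
    exact ⟨fun h => h.2 v rfl, fun h => ⟨Finset.mem_univ _, fun z hz => (Sum.inl.inj hz) ▸ h⟩⟩
  have hU' := twLap_isUnit _ (subGraph_connected hN ho hconn) (subC o C) σ'
    (subInterior G N Vi) (Sum.inl b)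
      (fun h => hb ((hint b).mp h)) hCpos' hσ'pm
  have hprod : ∀ e : G.edgeSet, gaugeProd G N o σ' e N = σ (o e.1).1 (o e.1).2 := by
    intro e
    rcases hσpm _ _ (o_adj ho e) with h | h
    · rw [h]
      exact Finset.prod_eq_one fun j hj => hσ'one e h j (Finset.mem_range.mp hj)
    · obtain ⟨j₀, hj₀, h1, h2⟩ := hσ'negone e h
      rw [h, ← h1]
      exact Finset.prod_eq_single j₀ (fun j hj hne => h2 j (Finset.mem_range.mp hj) hne)
        (fun hn => absurd (Finset.mem_range.mpr hj₀) hn)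
  obtain ⟨f, hf0, hfL⟩ := twistedGreen_exists G C σ Vi hU ⟨y, hy⟩
  rw [twistedGreen_eq G C σ Vi hU f hf0 ⟨y, hy⟩ hfL ⟨x, hx⟩]
  refine twistedGreen_eq _ _ _ _ hU' (hext G N o σ' f) ?_ _ ?_ _
  · rintro (v | ⟨e, k⟩) hv
    · exact hf0 v fun h => hv ((hint v).mpr h)
    · refine absurd ?_ hv
      exact Finset.mem_filter.mpr ⟨Finset.mem_univ _, fun z hz => by cases hz⟩
  · rintro (v | ⟨e, k⟩) hv
    · rw [twLap_hext_inl hN ho C hCsym σ hσsym σ' hσ'sym hσ'pm hprod f v,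
        hfL v ((hint v).mp hv)]
      simp only [Sum.inl.injEq]
      by_cases hvy : v = y <;> simp [hvy]
    · rw [twLap_hext_inr hN ho C σ' hσ'sym hσ'pm f e k]
      simp
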